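/- arXiv:2305.00563 — 5 statements merged into one kernel-verified Lean document; each statement's English description precedes it below -/
import Mathlib

section
/- For every real u > 1, the function σ satisfies the terminating series σ(u) = 1 + Σ_{k integer, 0 < k < u} P_k(u), where each Furry probability P_k(u) is positive for u > k. -/
/-- For every real `u > 1`, the Buchstab-related function `σ`
(the unique continuous function with `σ(u) = 1` on `[0,1]` and `u·σ′(u) = σ(u−1)` for `u > 1`)
satisfies the terminating series `σ(u) = 1 + ∑_{0 < k < u} P_k(u)`, where each Furry
probability `P_k(u)` is positive for `u > k`. -/
theorem buchstab_terminating_series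
    (σ : ℝ → ℝ) (P : ℕ → ℝ → ℝ)
    (hσcont : ContinuousOn σ (Set.Ici 0))
    (hσinit : ∀ u : ℝ, 0 ≤ u → u ≤ 1 → σ u = 1)
    (hσderiv : ∀ u : ℝ, 1 < u → HasDerivAt σ (σ (u - 1) / u) u)
    (hP0 : ∀ u : ℝ, 0 ≤ u → P 0 u = 1)
    (hPcont : ∀ k : ℕ, ContinuousOn (P (k + 1)) (Set.Ici ((k : ℝ) + 1)))
    (hPinit : ∀ k : ℕ, P (k + 1) ((k : ℝ) + 1) = 0)
    (hPderiv : ∀ k : ℕ, ∀ u : ℝ, (k : ℝ) + 1 < u →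
      HasDerivAt (P (k + 1)) (P k (u - 1) / u) u) :
    (∀ u : ℝ, 1 < u → σ u = 1 + ∑ k ∈ Finset.Ioo 0 ⌈u⌉₊, P k u) ∧
    (∀ k : ℕ, 0 < k → ∀ u : ℝ, (k : ℝ) < u → 0 < P k u) := by
  have key : ∀ n : ℕ, ∀ u : ℝ, (n : ℝ) ≤ u → u ≤ n + 1 →
      σ u = 1 + ∑ k ∈ Finset.range n, P (k + 1) u := by
    intro n
    induction n with
    | zero =>
      intro u h0 h1
      simp at h0 h1
      simpa using hσinit u h0 h1
    | succ n ih =>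
      intro u h0 h1
      push_cast at h0 h1
      have hn : (0 : ℝ) ≤ n := Nat.cast_nonneg n
      have base : σ ((n : ℝ) + 1) = 1 + ∑ k ∈ Finset.range (n + 1), P (k + 1) ((n : ℝ) + 1) := by
        rw [Finset.sum_range_succ, hPinit n, add_zero]
        exact ih _ (by linarith) le_rfl
      rcases h0.eq_or_lt with h | h
      · rw [← h]; exact base
      obtain ⟨c, ⟨hc1, hc2⟩, hc⟩ := exists_hasDerivAt_eq_slope
        (fun x => σ x - ∑ k ∈ Finset.range (n + 1), P (k + 1) x)
        (fun x => σ (x - 1) / x - ∑ k ∈ Finset.range (n + 1), P k (x - 1) / x) h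
        (by
          apply ContinuousOn.sub
          · exact hσcont.mono (fun x hx => by
              have := hx.1
              simp only [Set.mem_Ici]; linarith)
          · apply continuousOn_finsetSum
            intro k hk
            have hk' : (k : ℝ) ≤ n := by
              have := Finset.mem_range.mp hk
              exact_mod_cast Nat.lt_succ_iff.mp this
            exact (hPcont k).mono (fun x hx => by
              have := hx.1
              simp only [Set.mem_Ici]; linarith))
        (by
          intro x hx
          have hx1 := hx.1
          apply HasDerivAt.sub
          · exact hσderiv x (by linarith)
          · apply HasDerivAt.fun_sum
            intro k hk
            have hk' : (k : ℝ) ≤ n := by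
              have := Finset.mem_range.mp hk
              exact_mod_cast Nat.lt_succ_iff.mp this
            exact hPderiv k x (by linarith))
      have hz : σ (c - 1) / c - ∑ k ∈ Finset.range (n + 1), P k (c - 1) / c = 0 := by
        rw [← Finset.sum_div, Finset.sum_range_succ', hP0 (c - 1) (by linarith),
          ih (c - 1) (by linarith) (by linarith)]
        ring
      simp only [hz] at hc
      have hne : u - ((n : ℝ) + 1) ≠ 0 := by linarith
      have := (div_eq_zero_iff.mp hc.symm).resolve_right hne
      linarith
  have pos : ∀ k : ℕ, ∀ u : ℝ, (k : ℝ) < u → 0 < P k u := by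
    intro k
    induction k with
    | zero =>
      intro u hu
      simp at hu
      rw [hP0 u hu.le]; exact one_pos
    | succ k ih =>
      intro u hu
      push_cast at hu
      have hk : (0 : ℝ) ≤ k := Nat.cast_nonneg k
      obtain ⟨c, ⟨hc1, hc2⟩, hc⟩ := exists_hasDerivAt_eq_slope (P (k + 1))
        (fun x => P k (x - 1) / x) hu
        ((hPcont k).mono (fun x hx => hx.1)) (fun x hx => hPderiv k x hx.1)
      have h1 : 0 < P k (c - 1) / c := div_pos (ih _ (by linarith)) (by linarith)
      simp only [hPinit k, sub_zero] at hc
      rw [hc] at h1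
      exact (div_pos_iff_of_pos_right (by linarith)).mp h1
  refine ⟨?_, fun k _ => pos k⟩
  intro u hu
  obtain ⟨n, hn⟩ : ∃ n, ⌈u⌉₊ = n + 1 :=
    Nat.exists_eq_succ_of_ne_zero (Nat.ceil_pos.mpr (by linarith)).ne'
  have h1 : (n : ℝ) < u := Nat.lt_ceil.mp (by omega)
  have h2 : u ≤ (n : ℝ) + 1 := by
    have := Nat.le_ceil u
    rw [hn] at this
    exact_mod_cast this
  have h3 : Finset.Ioo 0 (n + 1) = Finset.Ico 1 (n + 1) := by
    ext x; simp only [Finset.mem_Ioo, Finset.mem_Ico]; omega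
  rw [hn, h3, Finset.sum_Ico_eq_sum_range, key n u h1.le h2]
  simp [add_comm]
end

section
/- For every real u > 1, the Dickman function satisfies the terminating alternating series ρ(u) = 1 + Σ_{k integer, 0 < k < u} (−1)^k · P_k(u). -/
/-- For every real `u > 1`, the Dickman function
(the unique continuous function with `ρ(u) = 1` on `[0,1]` and `u·ρ′(u) = −ρ(u−1)` for `u > 1`)
satisfies the terminating alternating series `ρ(u) = 1 + ∑_{0 < k < u} (−1)^k · P_k(u)`. -/
theorem dickman_terminating_series
    (ρ : ℝ → ℝ) (P : ℕ → ℝ → ℝ)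
    (hρcont : ContinuousOn ρ (Set.Ici 0))
    (hρinit : ∀ u : ℝ, 0 ≤ u → u ≤ 1 → ρ u = 1)
    (hρderiv : ∀ u : ℝ, 1 < u → HasDerivAt ρ (-ρ (u - 1) / u) u)
    (hP0 : ∀ u : ℝ, 0 ≤ u → P 0 u = 1)
    (hPcont : ∀ k : ℕ, ContinuousOn (P (k + 1)) (Set.Ici ((k : ℝ) + 1)))
    (hPinit : ∀ k : ℕ, P (k + 1) ((k : ℝ) + 1) = 0)
    (hPderiv : ∀ k : ℕ, ∀ u : ℝ, (k : ℝ) + 1 < u →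
      HasDerivAt (P (k + 1)) (P k (u - 1) / u) u) :
    ∀ u : ℝ, 1 < u → ρ u = 1 + ∑ k ∈ Finset.Ioo 0 ⌈u⌉₊, (-1 : ℝ) ^ k * P k u := by
  have key : ∀ n : ℕ, ∀ u : ℝ, (n : ℝ) ≤ u → u ≤ n + 1 →
      ρ u = 1 + ∑ k ∈ Finset.range n, (-1 : ℝ) ^ (k + 1) * P (k + 1) u := by
    intro n
    induction n with
    | zero =>
      intro u h0 h1
      simp only [Nat.cast_zero, zero_add] at h0 h1
      simp [hρinit u h0 h1]
    | succ n ih =>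
      intro u h0 h1
      push_cast at h0 h1
      have hn : (0 : ℝ) ≤ n := Nat.cast_nonneg n
      have hleft : ρ (n + 1) = 1 + ∑ k ∈ Finset.range (n + 1),
          (-1 : ℝ) ^ (k + 1) * P (k + 1) (n + 1) := by
        rw [Finset.sum_range_succ, hPinit n, ih (n + 1) (by linarith) le_rfl]
        ring
      rcases h0.eq_or_lt with h | hlt
      · rw [← h]; exact hleft
      obtain ⟨c, ⟨hc0, hc1⟩, hc⟩ := exists_hasDerivAt_eq_slope
        (fun x => ρ x - (1 + ∑ k ∈ Finset.range (n + 1), (-1 : ℝ) ^ (k + 1) * P (k + 1) x))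
        (fun x => -ρ (x - 1) / x -
          (∑ k ∈ Finset.range (n + 1), (-1 : ℝ) ^ (k + 1) * (P k (x - 1) / x))) hlt
        (by
          apply ContinuousOn.sub
          · exact hρcont.mono fun x hx => by
              have := hx.1
              simp only [Set.mem_Ici]; linarith
          · apply ContinuousOn.add continuousOn_const
            apply continuousOn_finsetSum
            intro k hk
            apply ContinuousOn.mul continuousOn_const
            refine (hPcont k).mono fun x hx => ?_
            have h2 : (k : ℝ) ≤ n := by
              exact_mod_cast Nat.lt_succ_iff.mp (Finset.mem_range.mp hk)
            have := hx.1
            simp only [Set.mem_Ici]; linarith)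
        (by
          intro x hx
          have hx1 := hx.1
          refine (hρderiv x (by linarith)).sub (HasDerivAt.const_add 1 ?_)
          apply HasDerivAt.fun_sum
          intro k hk
          have h2 : (k : ℝ) ≤ n := by
            exact_mod_cast Nat.lt_succ_iff.mp (Finset.mem_range.mp hk)
          exact (hPderiv k x (by linarith)).const_mul _)
      have hz : -ρ (c - 1) / c -
          (∑ k ∈ Finset.range (n + 1), (-1 : ℝ) ^ (k + 1) * (P k (c - 1) / c)) = 0 := by
        rw [ih (c - 1) (by linarith) (by linarith)]
        have e : ∑ k ∈ Finset.range (n + 1), (-1 : ℝ) ^ (k + 1) * (P k (c - 1) / c)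
            = -(∑ k ∈ Finset.range (n + 1), (-1 : ℝ) ^ k * P k (c - 1)) / c := by
          rw [← Finset.sum_neg_distrib, Finset.sum_div]
          refine Finset.sum_congr rfl fun k _ => ?_
          ring
        rw [e, Finset.sum_range_succ', hP0 (c - 1) (by linarith)]
        ring
      simp only [hz] at hc
      have hne : u - (n + 1) ≠ 0 := by linarith
      have h3 := (div_eq_zero_iff.mp hc.symm).resolve_right hne
      linarith
  intro u hu
  obtain ⟨n, hn⟩ : ∃ n, ⌈u⌉₊ = n + 1 :=
    Nat.exists_eq_succ_of_ne_zero (Nat.ceil_pos.mpr (by linarith)).ne'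
  have hle : u ≤ n + 1 := by
    have := Nat.le_ceil u
    rw [hn] at this
    exact_mod_cast this
  have hlt : (n : ℝ) < u := Nat.lt_ceil.mp (by omega)
  rw [key n u hlt.le hle, hn]
  have : Finset.Ioo 0 (n + 1) = Finset.Ico 1 (n + 1) := by
    ext; simp [Nat.lt_iff_add_one_le]
  rw [this, Finset.sum_Ico_eq_sum_range]
  simp [add_comm]
end

section
/- (Theorem 1) For every real y ∈ [0,1] and every positive integer n, the Dickman function satisfies ρ(n−y) = ρ(n) + Σ_{j=1}^{n−1} ρ(n−j)·M_{j,n}(y). -/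
/-- The multiple polylogarithm `M_{j,n}(y)`: the nested sum over strictly decreasing
tuples `n₁ > n₂ > … > n_j > 0` of `∏ᵢ zᵢ^{nᵢ}/nᵢ`, where `z₁ = y/n` and
`zᵢ = (n+2−i)/(n+1−i)` for `1 < i ≤ j` (indices shifted by one in Lean:
the `i`-th coordinate of `Fin j` corresponds to the paper's index `i+1`).
By convention `M_{0,n}(y) = 1`. -/
noncomputable def M (j n : ℕ) (y : ℝ) : ℝ :=
  ∑' f : {f : Fin j → ℕ // StrictAnti f ∧ ∀ i, 0 < f i},
    ∏ i : Fin j,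
      (if (i : ℕ) = 0 then y / n else ((n : ℝ) + 1 - (i : ℕ)) / ((n : ℝ) - (i : ℕ))) ^ (f.1 i)
        / (f.1 i : ℝ)

abbrev SS (j : ℕ) : Type := {f : Fin j → ℕ // StrictAnti f ∧ ∀ i, 0 < f i}

noncomputable def FF (j n : ℕ) (y : ℝ) (f : SS j) : ℝ :=
    ∏ i : Fin j,
      (if (i : ℕ) = 0 then y / n else ((n : ℝ) + 1 - (i : ℕ)) / ((n : ℝ) - (i : ℕ))) ^ (f.1 i)
        / (f.1 i : ℝ)

theorem M_eq (j n : ℕ) (y : ℝ) : M j n y = ∑' f : SS j, FF j n y f := rfl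

def topp {j : ℕ} (f : Fin j → ℕ) : ℕ := if h : 0 < j then f ⟨0, h⟩ else 0

theorem le_topp {j : ℕ} (f : SS j) (i : Fin j) : f.1 i ≤ topp f.1 := by
  have h : 0 < j := by have := i.2; omega
  unfold topp
  rw [dif_pos h]
  exact f.2.1.antitone (Fin.mk_le_of_le_val (Nat.zero_le _))

theorem FF_top (j n : ℕ) (y : ℝ) (f : SS j) : FF j n y f = y ^ topp f.1 * FF j n 1 f := by
  unfold FF
  cases j with
  | zero => simp [topp]
  | succ j =>
    rw [Fin.prod_univ_succ, Fin.prod_univ_succ]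
    have : topp f.1 = f.1 0 := by simp [topp]
    rw [this]
    simp [div_pow]
    ring

def consS (j : ℕ) (p : SS j × ℕ) : SS (j + 1) :=
  ⟨Fin.cons (topp p.1.1 + p.2 + 1) p.1.1, by
    constructor
    · intro a b hab
      induction b using Fin.cases with
      | zero => exact absurd hab (by simp)
      | succ b =>
        induction a using Fin.cases with
        | zero =>
          simp only [Fin.cons_zero, Fin.cons_succ]
          have := le_topp p.1 b
          omega
        | succ a =>
          simp only [Fin.cons_succ]
          exact p.1.2.1 (by simpa using hab)
    · intro i
      induction i using Fin.cases with
      | zero => simp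
      | succ i => simpa using p.1.2.2 i⟩

theorem consS_bij (j : ℕ) : Function.Bijective (consS j) := by
  constructor
  · rintro ⟨f, k⟩ ⟨g, l⟩ h
    have h1 := congrArg Subtype.val h
    simp only [consS] at h1
    obtain ⟨h2, h3⟩ := Fin.cons_injective2 h1
    have h4 : f = g := Subtype.ext h3
    subst h4
    have : k = l := by omega
    rw [this]
  · intro g
    have hg : StrictAnti (Fin.tail g.1) ∧ ∀ i, 0 < Fin.tail g.1 i :=
      ⟨fun a b hab => g.2.1 (by simpa using hab), fun i => g.2.2 _⟩
    have ht : topp (Fin.tail g.1) < g.1 0 := by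
      unfold topp
      split_ifs with h
      · exact g.2.1 (by simp [Fin.lt_def])
      · exact g.2.2 0
    refine ⟨(⟨Fin.tail g.1, hg⟩, g.1 0 - topp (Fin.tail g.1) - 1), ?_⟩
    apply Subtype.ext
    simp only [consS]
    have : topp (Fin.tail g.1) + (g.1 0 - topp (Fin.tail g.1) - 1) + 1 = g.1 0 := by omega
    rw [this]
    exact Fin.cons_self_tail g.1

theorem FF_cons (j n : ℕ) (y : ℝ) (p : SS j × ℕ) :
    FF (j + 1) (n + 1) y (consS j p) =
      FF j n 1 p.1 * y ^ (topp p.1.1 + p.2 + 1) / (topp p.1.1 + p.2 + 1)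
        / ((n : ℝ) + 1) ^ (p.2 + 1) := by
  have h1 : FF (j + 1) (n + 1) y (consS j p) =
      (y / ((n : ℝ) + 1)) ^ (topp p.1.1 + p.2 + 1) / ((topp p.1.1 : ℝ) + p.2 + 1) *
        FF j n ((n : ℝ) + 1) p.1 := by
    unfold FF
    rw [Fin.prod_univ_succ]
    congr 1
    · simp [consS]
    · apply Finset.prod_congr rfl
      intro i _
      simp only [consS, Fin.cons_succ, Fin.val_succ]
      congr 2
      rw [if_neg (Nat.succ_ne_zero _)]
      push_cast
      split_ifs with h
      · rw [h]; simp
      · congr 1 <;> ring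
  rw [h1, FF_top]
  have : ((n : ℝ) + 1) ≠ 0 := by positivity
  rw [div_pow]
  have h3 : ((n : ℝ) + 1) ^ (topp p.1.1 + p.2 + 1) =
    ((n : ℝ) + 1) ^ (topp p.1.1) * ((n : ℝ) + 1) ^ (p.2 + 1) := by ring
  rw [h3]
  have : ((topp p.1.1 : ℝ) + p.2 + 1) ≠ 0 := by positivity
  field_simp

theorem FF_nonneg (j n : ℕ) (hj : j ≤ n) (y : ℝ) (hy : 0 ≤ y) (f : SS j) : 0 ≤ FF j n y f := by
  unfold FF
  apply Finset.prod_nonneg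
  intro i _
  have : (i : ℝ) + 1 ≤ n := by exact_mod_cast (by have := i.2; omega : (i : ℕ) + 1 ≤ n)
  split_ifs
  · positivity
  · have h1 : (0 : ℝ) ≤ (n : ℝ) + 1 - (i : ℕ) := by linarith
    have h2 : (0 : ℝ) ≤ (n : ℝ) - (i : ℕ) := by linarith
    positivity

theorem FF_mono (j n : ℕ) (hj : j ≤ n) (x y : ℝ) (hx : 0 ≤ x) (hxy : x ≤ y) (f : SS j) :
    FF j n x f ≤ FF j n y f := by
  rw [FF_top, FF_top j n y]
  have := FF_nonneg j n hj 1 zero_le_one f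
  gcongr

theorem geo (n : ℕ) (hn : 0 < n) (t : ℝ) (h0 : 0 ≤ t) (h1 : t ≤ 1) :
    HasSum (fun k : ℕ => t ^ k / ((n : ℝ) + 1) ^ (k + 1)) (1 / ((n : ℝ) + 1 - t)) := by
  have hn' : (1 : ℝ) ≤ n := by exact_mod_cast hn
  have hlt : t / ((n : ℝ) + 1) < 1 := by rw [div_lt_one (by positivity)]; linarith
  have := (hasSum_geometric_of_lt_one (by positivity) hlt).div_const ((n : ℝ) + 1)
  have e1 : (fun k : ℕ => t ^ k / ((n : ℝ) + 1) ^ (k + 1)) =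
      fun k : ℕ => (t / ((n : ℝ) + 1)) ^ k / ((n : ℝ) + 1) := by
    ext k
    rw [div_pow, pow_succ, div_div]
  have e2 : 1 / ((n : ℝ) + 1 - t) = (1 - t / ((n : ℝ) + 1))⁻¹ / ((n : ℝ) + 1) := by
    have : (n : ℝ) + 1 - t ≠ 0 := by linarith
    field_simp
  rw [e1, e2]
  exact this

theorem FF_summable1 (j : ℕ) : ∀ n, j < n → Summable (FF j n 1) := by
  induction j with
  | zero =>
    intro n _
    have : Finite (SS 0) := inferInstance
    exact Summable.of_finite
  | succ j ih =>
    intro n hn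
    obtain ⟨n, rfl⟩ : ∃ m, n = m + 1 := ⟨n - 1, by omega⟩
    have hn : j < n := by omega
    rw [← (Equiv.ofBijective _ (consS_bij j)).summable_iff]
    have := (ih n hn).mul_of_nonneg (geo n (by omega) 1 zero_le_one le_rfl).summable
      (fun f => FF_nonneg j n hn.le 1 zero_le_one f) (fun k => by positivity)
    refine Summable.of_nonneg_of_le (fun p => ?_) (fun p => ?_) this
    · exact FF_nonneg _ _ (by omega) _ zero_le_one _
    · have h0 := FF_nonneg j n hn.le 1 zero_le_one p.1
      simp only [Function.comp, Equiv.ofBijective_apply]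
      rw [FF_cons]
      simp only [one_pow, mul_one]
      rw [mul_one_div]
      gcongr
      apply div_le_self h0
      have : (0 : ℝ) ≤ topp p.1.1 + p.2 := by positivity
      linarith

theorem FF_summable (j n : ℕ) (hj : j < n) (y : ℝ) (h0 : 0 ≤ y) (h1 : y ≤ 1) :
    Summable (FF j n y) :=
  Summable.of_nonneg_of_le (fun f => FF_nonneg j n hj.le y h0 f)
    (fun f => FF_mono j n hj.le y 1 h0 h1 f) (FF_summable1 j n hj)

theorem M_mono (j n : ℕ) (hj : j < n) : MonotoneOn (M j n) (Set.Icc 0 1) := by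
  intro x hx y hy hxy
  rw [M_eq, M_eq]
  exact (FF_summable j n hj x hx.1 hx.2).tsum_le_tsum
    (fun f => FF_mono j n hj.le x y hx.1 hxy f) (FF_summable j n hj y hy.1 hy.2)

theorem M_int (j n : ℕ) (hj : j < n) (y : ℝ) (h0 : 0 ≤ y) (h1 : y ≤ 1) :
    IntervalIntegrable (fun t => M j n t * (1 / ((n : ℝ) + 1 - t))) MeasureTheory.volume 0 y := by
  apply IntervalIntegrable.mul_continuousOn
  · apply MonotoneOn.intervalIntegrable
    rw [Set.uIcc_of_le h0]
    exact (M_mono j n hj).mono (Set.Icc_subset_Icc le_rfl h1)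
  · rw [Set.uIcc_of_le h0]
    apply ContinuousOn.div continuousOn_const (by fun_prop)
    intro t ht
    have : (1 : ℝ) ≤ n := by exact_mod_cast (by omega : 1 ≤ n)
    have := ht.2
    linarith

set_option maxHeartbeats 2000000 in
theorem M_succ (j n : ℕ) (hj : j < n) (y : ℝ) (h0 : 0 ≤ y) (h1 : y ≤ 1) :
    M (j + 1) (n + 1) y = ∫ t in (0 : ℝ)..y, M j n t * (1 / ((n : ℝ) + 1 - t)) := by
  have hn : 0 < n := by omega
  have : Countable (SS j × ℕ) := inferInstance
  have key := intervalIntegral.hasSum_integral_of_dominated_convergence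
    (μ := MeasureTheory.volume) (a := 0) (b := y)
    (F := fun (p : SS j × ℕ) (t : ℝ) => FF j n t p.1 * (t ^ p.2 / ((n : ℝ) + 1) ^ (p.2 + 1)))
    (f := fun t => M j n t * (1 / ((n : ℝ) + 1 - t)))
    (fun p _ => FF j n 1 p.1 * (1 ^ p.2 / ((n : ℝ) + 1) ^ (p.2 + 1)))
    (by
      intro p
      apply Continuous.aestronglyMeasurable
      have : (fun t => FF j n t p.1) = fun t => t ^ topp p.1.1 * FF j n 1 p.1 := by
        ext t; exact FF_top _ _ _ _
      apply Continuous.mul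
      · rw [this]; fun_prop
      · fun_prop)
    (by
      intro p
      refine Filter.Eventually.of_forall fun t ht => ?_
      rw [Set.uIoc_of_le h0] at ht
      have ht0 := ht.1.le
      have ht1 := ht.2.trans h1
      have hF := FF_nonneg j n hj.le t ht0 p.1
      rw [Real.norm_of_nonneg (by positivity)]
      have := FF_mono j n hj.le t 1 ht0 ht1 p.1
      have := FF_nonneg j n hj.le 1 zero_le_one p.1
      gcongr)
    (by
      refine Filter.Eventually.of_forall fun t ht => ?_
      exact (FF_summable1 j n hj).mul_of_nonneg (geo n hn 1 zero_le_one le_rfl).summable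
        (fun f => FF_nonneg j n hj.le 1 zero_le_one f) (fun k => by positivity))
    (by simp)
    (by
      refine Filter.Eventually.of_forall fun t ht => ?_
      rw [Set.uIoc_of_le h0] at ht
      have ht0 := ht.1.le
      have ht1 := ht.2.trans h1
      have hs := FF_summable j n hj t ht0 ht1
      have hg := geo n hn t ht0 ht1
      exact HasSum.mul (by rw [M_eq]; exact hs.hasSum) hg
        (hs.mul_of_nonneg hg.summable (fun f => FF_nonneg j n hj.le t ht0 f)
          (fun k => by positivity)))
  rw [← key.tsum_eq, M_eq, ← (Equiv.ofBijective _ (consS_bij j)).tsum_eq]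
  congr 1
  ext p
  simp only [Equiv.ofBijective_apply]
  rw [FF_cons]
  have : (fun t : ℝ => FF j n t p.1 * (t ^ p.2 / ((n : ℝ) + 1) ^ (p.2 + 1))) =
      fun t => t ^ (topp p.1.1 + p.2) * (FF j n 1 p.1 / ((n : ℝ) + 1) ^ (p.2 + 1)) := by
    ext t
    rw [FF_top, pow_add]
    ring
  rw [this, intervalIntegral.integral_mul_const, integral_pow]
  push_cast
  simp
  ring

theorem M_zero (n : ℕ) (y : ℝ) : M 0 n y = 1 := by
  have : Unique (SS 0) := ⟨⟨⟨Fin.elim0, fun a => a.elim0, fun a => a.elim0⟩⟩,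
    fun a => Subtype.ext (funext fun i => i.elim0)⟩
  rw [M_eq, tsum_fintype]
  simp [FF]

theorem main_range
    (ρ : ℝ → ℝ)
    (hρcont : ContinuousOn ρ (Set.Ici 0))
    (hρinit : ∀ u : ℝ, 0 ≤ u → u ≤ 1 → ρ u = 1)
    (hρderiv : ∀ u : ℝ, 1 < u → HasDerivAt ρ (-ρ (u - 1) / u) u)
    (n : ℕ) : ∀ (y : ℝ) (hy0 : 0 ≤ y) (hy1 : y ≤ 1),
    ρ ((n : ℝ) + 1 - y) = ∑ j ∈ Finset.range (n + 1), ρ ((n : ℝ) + 1 - (j : ℝ)) * M j (n + 1) y := by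
  induction n with
  | zero =>
    intro y hy0 hy1
    simp only [Nat.cast_zero, zero_add, Finset.sum_range_one, M_zero]
    rw [hρinit _ (by linarith) (by linarith), hρinit _ (by norm_num) (by norm_num)]
    norm_num
  | succ n ih =>
    intro y hy0 hy1
    have hn0 : (0 : ℝ) ≤ n := by positivity
    have hc : ContinuousOn (fun t : ℝ => ρ ((n : ℝ) + 1 + 1 - t)) (Set.Icc 0 y) := by
      apply hρcont.comp (by fun_prop)
      intro t ht
      have := ht.2
      simp only [Set.mem_Ici]; linarith
    have hc2 : ContinuousOn (fun t : ℝ => ρ ((n : ℝ) + 1 - t) * (1 / ((n : ℝ) + 1 + 1 - t)))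
        (Set.Icc 0 y) := by
      apply ContinuousOn.mul
      · apply hρcont.comp (by fun_prop)
        intro t ht
        have := ht.2
        simp only [Set.mem_Ici]; linarith
      · apply ContinuousOn.div continuousOn_const (by fun_prop)
        intro t ht
        have := ht.2
        linarith
    have ftc := intervalIntegral.integral_eq_sub_of_hasDerivAt_of_le
      (f := fun t : ℝ => ρ ((n : ℝ) + 1 + 1 - t))
      (f' := fun t : ℝ => ρ ((n : ℝ) + 1 - t) * (1 / ((n : ℝ) + 1 + 1 - t))) hy0 hc
      (by
        intro t ht
        have := ht.2
        have h := hρderiv ((n : ℝ) + 1 + 1 - t) (by linarith)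
        have h2 := h.comp_const_sub ((n : ℝ) + 1 + 1) t
        convert h2 using 1
        rw [show (n : ℝ) + 1 + 1 - t - 1 = (n : ℝ) + 1 - t by ring]
        ring)
      (by
        apply ContinuousOn.intervalIntegrable
        rwa [Set.uIcc_of_le hy0])
    have hsum : (∫ t in (0 : ℝ)..y, ρ ((n : ℝ) + 1 - t) * (1 / ((n : ℝ) + 1 + 1 - t))) =
        ∑ j ∈ Finset.range (n + 1), ρ ((n : ℝ) + 1 - (j : ℝ)) * M (j + 1) (n + 1 + 1) y := by
      rw [intervalIntegral.integral_congr (g := fun t => ∑ j ∈ Finset.range (n + 1),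
        ρ ((n : ℝ) + 1 - (j : ℝ)) * (M j (n + 1) t * (1 / (((n + 1 : ℕ) : ℝ) + 1 - t))))]
      · rw [intervalIntegral.integral_finsetSum]
        · apply Finset.sum_congr rfl
          intro j hj
          rw [intervalIntegral.integral_const_mul,
            M_succ j (n + 1) (by simpa using hj) y hy0 hy1]
        · intro j hj
          exact (M_int j (n + 1) (by simpa using hj) y hy0 hy1).const_mul _
      · intro t ht
        rw [Set.uIcc_of_le hy0] at ht
        simp only
        rw [ih t ht.1 (ht.2.trans hy1), Finset.sum_mul]
        push_cast
        apply Finset.sum_congr rfl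
        intro j _
        ring
    rw [hsum] at ftc
    rw [Finset.sum_range_succ']
    push_cast
    simp only [M_zero, sub_zero, mul_one] at ftc ⊢
    have h4 : ∀ j : ℕ, (n : ℝ) + 1 + 1 - ((j : ℝ) + 1) = (n : ℝ) + 1 - j := fun j => by ring
    simp only [h4]
    linarith

/-- Theorem 1: For every real `y ∈ [0,1]` and every positive integer `n`,
the Dickman function satisfies `ρ(n−y) = ρ(n) + ∑_{j=1}^{n−1} ρ(n−j)·M_{j,n}(y)`. -/
theorem dickman_polylog_expansion
    (ρ : ℝ → ℝ)
    (hρcont : ContinuousOn ρ (Set.Ici 0))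
    (hρinit : ∀ u : ℝ, 0 ≤ u → u ≤ 1 → ρ u = 1)
    (hρderiv : ∀ u : ℝ, 1 < u → HasDerivAt ρ (-ρ (u - 1) / u) u)
    (n : ℕ) (hn : 0 < n) (y : ℝ) (hy0 : 0 ≤ y) (hy1 : y ≤ 1) :
    ρ ((n : ℝ) - y) = ρ (n : ℝ) + ∑ j ∈ Finset.Icc 1 (n - 1), ρ ((n : ℝ) - (j : ℝ)) * M j n y := by
  obtain ⟨n, rfl⟩ : ∃ m, n = m + 1 := ⟨n - 1, by omega⟩
  have h := main_range ρ hρcont hρinit hρderiv n y hy0 hy1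
  rw [Finset.sum_range_eq_add_Ico _ (Nat.succ_pos n)] at h
  push_cast
  rw [h, M_zero]
  simp only [Nat.cast_zero, sub_zero, mul_one]
  rfl
end

section
/- (Theorem 3) For every integer k ≥ 1 and every real u ≥ k, the Furry probability P_k(u) equals the convergent nested sum P_k(u) = Σ_{n_1 > n_2 > … > n_k > 0} ∏_{i=1}^{k} z_i^{n_i}/n_i, where z_i = 1 − 1/(u−k+i) for 1 ≤ i ≤ k. -/
/-- The nested sum `∑_{n₁ > n₂ > … > n_k > 0} ∏ᵢ zᵢ^{nᵢ}/nᵢ` with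
`zᵢ = 1 − 1/(u−k+i)` for `1 ≤ i ≤ k` (in Lean, `i : Fin k` corresponds to the
paper's index `i+1`). -/
noncomputable def FurrySum (k : ℕ) (u : ℝ) : ℝ :=
  ∑' f : {f : Fin k → ℕ // StrictAnti f ∧ ∀ i, 0 < f i},
    ∏ i : Fin k, (1 - 1 / (u - (k : ℝ) + ((i : ℕ) + 1))) ^ (f.1 i) / (f.1 i : ℝ)

noncomputable def furryF : ℕ → ℕ → ℝ → ℝ
  | 0, _, _ => 1
  | k + 1, N, v => ∑ n ∈ Finset.range N,
      (1 - 1 / (v + 1)) ^ (n + 1) / ((n : ℝ) + 1) * furryF k n (v + 1)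

lemma furryF_zero (N : ℕ) (v : ℝ) : furryF 0 N v = 1 := by simp [furryF]

lemma furryF_succ_zero (k : ℕ) (v : ℝ) : furryF (k + 1) 0 v = 0 := by simp [furryF]

lemma furryF_succ_succ (k N : ℕ) (v : ℝ) : furryF (k + 1) (N + 1) v =
    furryF (k + 1) N v + (1 - 1 / (v + 1)) ^ (N + 1) / ((N : ℝ) + 1) * furryF k N (v + 1) := by
  simp [furryF, Finset.sum_range_succ]

lemma furry_z_nonneg {v : ℝ} (hv : 0 ≤ v) : 0 ≤ 1 - 1 / (v + 1) := by
  have : 1 / (v + 1) ≤ 1 := by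
    rw [div_le_one (by linarith)]; linarith
  linarith

lemma furryF_nonneg (k N : ℕ) {v : ℝ} (hv : 0 ≤ v) : 0 ≤ furryF k N v := by
  induction k generalizing N v with
  | zero => simp [furryF]
  | succ k ih =>
    simp only [furryF]
    refine Finset.sum_nonneg fun n _ => ?_
    have := furry_z_nonneg hv
    have := ih n (v := v + 1) (by linarith)
    positivity

lemma furryF_at_zero (k N : ℕ) : furryF (k + 1) N 0 = 0 := by
  simp [furryF]

lemma furry_z_deriv (N : ℕ) {v : ℝ} (hv : -1 < v) :
    HasDerivAt (fun x : ℝ => (1 - 1 / (x + 1)) ^ (N + 1) / ((N : ℝ) + 1))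
      ((1 - 1 / (v + 1)) ^ N / (v + 1) ^ 2) v := by
  have h0 : v + 1 ≠ 0 := by linarith
  have h1 : HasDerivAt (fun x : ℝ => x + 1) 1 v := (hasDerivAt_id v).add_const 1
  have h2 := ((h1.inv h0).const_sub 1).pow (N + 1) |>.div_const ((N : ℝ) + 1)
  have hN : (N : ℝ) + 1 ≠ 0 := by positivity
  have h3 := h2.congr_deriv (f' := _) (g' := (1 - 1 / (v + 1)) ^ N / (v + 1) ^ 2) (by
    simp only [Pi.inv_apply, Nat.add_sub_cancel]
    push_cast
    field_simp)
  simpa [one_div] using h3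

lemma furryF_deriv (k N : ℕ) {v : ℝ} (hv : -1 < v) :
    HasDerivAt (furryF (k + 1) N) (furryF k N v / (v + k + 1)
      - (1 - 1 / (v + 1)) ^ N / (v + 1) * furryF k N (v + 1)) v := by
  induction k generalizing N v with
  | zero =>
    have h0 : v + 1 ≠ 0 := by linarith
    induction N with
    | zero =>
      have : furryF (0 + 1) 0 = fun _ => (0 : ℝ) := by
        funext x; simp [furryF]
      rw [this]
      simpa [furryF] using hasDerivAt_const v (0 : ℝ)
    | succ N ihN =>
      have : furryF (0 + 1) (N + 1) = fun x => furryF (0 + 1) N x +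
          (1 - 1 / (x + 1)) ^ (N + 1) / ((N : ℝ) + 1) := by
        funext x; rw [furryF_succ_succ, furryF_zero, mul_one]
      rw [this]
      refine (ihN.add (furry_z_deriv N hv)).congr_deriv ?_
      simp only [furryF_zero, pow_succ]
      generalize (1 - 1 / (v + 1)) ^ N = t
      push_cast
      field_simp
      ring
  | succ k ih =>
    have h0 : v + 1 ≠ 0 := by linarith
    have h2 : v + 2 ≠ 0 := by linarith
    have hk : v + k + 2 ≠ 0 := by
      have : (0 : ℝ) ≤ k := by positivity
      linarith
    induction N with
    | zero =>
      have : furryF (k + 1 + 1) 0 = fun _ => (0 : ℝ) := by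
        funext x; simp [furryF]
      rw [this]
      simpa [furryF] using hasDerivAt_const v (0 : ℝ)
    | succ N ihN =>
      have : furryF (k + 1 + 1) (N + 1) = fun x => furryF (k + 1 + 1) N x +
          (1 - 1 / (x + 1)) ^ (N + 1) / ((N : ℝ) + 1) * furryF (k + 1) N (x + 1) := by
        funext x; rw [furryF_succ_succ]
      rw [this]
      have hs : HasDerivAt (fun x => furryF (k + 1) N (x + 1)) _ v :=
        (ih N (v := v + 1) (by linarith)).comp_add_const v 1
      refine (ihN.add ((furry_z_deriv N hv).mul hs)).congr_deriv ?_
      rw [furryF_succ_succ k N v, furryF_succ_succ k N (v + 1)]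
      have e1 : (1 - 1 / (v + 1)) ^ (N + 1) = (1 - 1 / (v + 1)) ^ N * (v / (v + 1)) := by
        rw [pow_succ]; congr 1; field_simp; ring
      have e2 : (1 - 1 / (v + 1 + 1)) ^ (N + 1)
          = (1 - 1 / (v + 1 + 1)) ^ N * ((v + 1) / (v + 2)) := by
        rw [pow_succ]; congr 1
        rw [show v + 1 + 1 = v + 2 by ring]; field_simp; ring
      rw [e1, e2]
      generalize (1 - 1 / (v + 1)) ^ N = t
      generalize (1 - 1 / (v + 1 + 1)) ^ N = s
      generalize furryF (k + 1) N (v + 1) = A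
      generalize furryF (k + 1) N v = B
      generalize furryF k N (v + 1 + 1) = C
      generalize furryF k N (v + 1) = D
      have hN : (N : ℝ) + 1 ≠ 0 := by positivity
      push_cast
      rw [show v + 1 + 1 = v + 2 by ring, show v + 1 + (k:ℝ) + 1 = v + k + 2 by ring,
        show v + ((k:ℝ) + 1) + 1 = v + k + 2 by ring]
      field_simp
      ring

lemma furry_bound (Q : ℕ → ℝ → ℝ) (hQ0 : ∀ v : ℝ, 0 ≤ v → Q 0 v = 1)
    (hQcont : ∀ k : ℕ, ContinuousOn (Q k) (Set.Ici 0))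
    (hQinit : ∀ k : ℕ, Q (k + 1) 0 = 0)
    (hQd : ∀ k : ℕ, ∀ v : ℝ, 0 < v → HasDerivAt (Q (k + 1)) (Q k v / (v + k + 1)) v)
    (k : ℕ) : ∀ V : ℝ, 0 ≤ V → ∃ C : ℝ, 0 ≤ C ∧ ∀ N : ℕ, ∀ v ∈ Set.Icc 0 V,
      furryF k N v ≤ Q k v ∧ Q k v - furryF k N v ≤ C * (1 - 1 / (V + 1)) ^ N := by
  induction k with
  | zero =>
    intro V hV
    refine ⟨0, le_rfl, fun N v hv => ?_⟩
    simp [furryF, hQ0 v hv.1]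
  | succ k ih =>
    intro V hV
    obtain ⟨C, hC, h⟩ := ih V hV
    obtain ⟨C', hC', h'⟩ := ih (V + 1) (by linarith)
    obtain ⟨M, hM⟩ := (isCompact_Icc (a := (0:ℝ)) (b := V + 1)).exists_bound_of_continuousOn
      ((hQcont k).mono Set.Icc_subset_Ici_self)
    have hM0 : 0 ≤ M := (norm_nonneg _).trans (hM 0 ⟨le_rfl, by linarith⟩)
    refine ⟨(C + M) * V, by positivity, fun N v hv => ?_⟩
    set r := 1 - 1 / (V + 1) with hr
    have hr0 : 0 ≤ r := furry_z_nonneg hV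
    have hcont : ContinuousOn (fun x => Q (k + 1) x - furryF (k + 1) N x) (Set.Icc 0 V) := by
      refine ((hQcont (k + 1)).mono Set.Icc_subset_Ici_self).sub fun x hx => ?_
      exact (furryF_deriv k N (v := x) (by linarith [hx.1])).continuousAt.continuousWithinAt
    have hd : ∀ x ∈ interior (Set.Icc 0 V),
        HasDerivAt (fun x => Q (k + 1) x - furryF (k + 1) N x)
        (Q k x / (x + k + 1) - (furryF k N x / (x + k + 1)
      - (1 - 1 / (x + 1)) ^ N / (x + 1) * furryF k N (x + 1))) x := by
      intro x hx
      rw [interior_Icc] at hx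
      exact (hQd k x hx.1).sub (furryF_deriv k N (v := x) (by linarith [hx.1]))
    have hdiff : DifferentiableOn ℝ (fun x => Q (k + 1) x - furryF (k + 1) N x)
        (interior (Set.Icc 0 V)) :=
      fun x hx => (hd x hx).differentiableAt.differentiableWithinAt
    have hlow : ∀ x ∈ interior (Set.Icc 0 V),
        0 ≤ deriv (fun x => Q (k + 1) x - furryF (k + 1) N x) x := by
      intro x hx
      rw [(hd x hx).deriv]
      rw [interior_Icc] at hx
      have a1 := (h N x ⟨hx.1.le, hx.2.le⟩).1
      have a2 := furryF_nonneg k N (v := x + 1) (by linarith [hx.1])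
      have a3 := furry_z_nonneg hx.1.le
      have hx0 := hx.1
      have a4 : furryF k N x / (x + k + 1) ≤ Q k x / (x + k + 1) := by gcongr
      have a5 : 0 ≤ (1 - 1 / (x + 1)) ^ N / (x + 1) * furryF k N (x + 1) := by positivity
      linarith
    have hup : ∀ x ∈ interior (Set.Icc 0 V),
        deriv (fun x => Q (k + 1) x - furryF (k + 1) N x) x ≤ (C + M) * r ^ N := by
      intro x hx
      rw [(hd x hx).deriv]
      rw [interior_Icc] at hx
      have hx0 := hx.1
      obtain ⟨a1, b1⟩ := h N x ⟨hx.1.le, hx.2.le⟩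
      have a2 := furryF_nonneg k N (v := x + 1) (by linarith [hx.1])
      have a3 := furry_z_nonneg hx.1.le
      have a6 : furryF k N (x + 1) ≤ M :=
        ((h' N (x + 1) ⟨by linarith, by linarith [hx.2]⟩).1.trans (le_abs_self _)).trans
          (hM (x + 1) ⟨by linarith, by linarith [hx.2]⟩)
      have a4 : (Q k x - furryF k N x) / (x + k + 1) ≤ C * r ^ N := by
        refine le_trans (div_le_self (by linarith) ?_) b1
        have : (0:ℝ) ≤ k := by positivity
        linarith
      have a7 : (1 - 1 / (x + 1)) ^ N ≤ r ^ N := by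
        refine pow_le_pow_left₀ a3 ?_ N
        rw [hr]
        have := one_div_le_one_div_of_le (show 0 < x + 1 by linarith)
          (show x + 1 ≤ V + 1 by linarith [hx.2])
        linarith
      have a5 : (1 - 1 / (x + 1)) ^ N / (x + 1) * furryF k N (x + 1) ≤ r ^ N * M := by
        refine mul_le_mul ?_ a6 a2 (by positivity)
        exact (div_le_self (by positivity) (by linarith)).trans a7
      rw [sub_div] at a4
      linarith
    have hz : (0:ℝ) ∈ Set.Icc 0 V := ⟨le_rfl, hV⟩
    have r1 := (convex_Icc (0:ℝ) V).mul_sub_le_image_sub_of_le_deriv hcont hdiff hlow 0 hz v hv hv.1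
    have r2 := (convex_Icc (0:ℝ) V).image_sub_le_mul_sub_of_deriv_le hcont hdiff hup 0 hz v hv hv.1
    simp only [hQinit, furryF_at_zero, sub_zero, zero_mul] at r1 r2
    refine ⟨by linarith, r2.trans ?_⟩
    have : (C + M) * r ^ N * v ≤ (C + M) * r ^ N * V := by
      gcongr
      exact hv.2
    linarith

lemma furry_tendsto (Q : ℕ → ℝ → ℝ) (hQ0 : ∀ v : ℝ, 0 ≤ v → Q 0 v = 1)
    (hQcont : ∀ k : ℕ, ContinuousOn (Q k) (Set.Ici 0))
    (hQinit : ∀ k : ℕ, Q (k + 1) 0 = 0)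
    (hQd : ∀ k : ℕ, ∀ v : ℝ, 0 < v → HasDerivAt (Q (k + 1)) (Q k v / (v + k + 1)) v)
    (k : ℕ) (v : ℝ) (hv : 0 ≤ v) :
    (∀ N, furryF k N v ≤ Q k v) ∧
    Filter.Tendsto (fun N => furryF k N v) Filter.atTop (nhds (Q k v)) := by
  obtain ⟨C, hC, h⟩ := furry_bound Q hQ0 hQcont hQinit hQd k v hv
  have hm : v ∈ Set.Icc 0 v := ⟨hv, le_rfl⟩
  refine ⟨fun N => (h N v hm).1, ?_⟩
  have hr1 : 1 - 1 / (v + 1) < 1 := by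
    have : 0 < 1 / (v + 1) := by positivity
    linarith
  have ht := (tendsto_pow_atTop_nhds_zero_of_lt_one (furry_z_nonneg hv) hr1).const_mul C
  have ht2 := ht.const_sub (Q k v)
  simp only [mul_zero, sub_zero] at ht2
  refine tendsto_of_tendsto_of_tendsto_of_le_of_le ht2 tendsto_const_nhds ?_ ?_
  · intro N
    have := (h N v hm).2
    simp only
    linarith
  · intro N
    exact (h N v hm).1

noncomputable def furryG : (k : ℕ) → ℕ → Finset (Fin k → ℕ)
  | 0, _ => Finset.univ
  | k + 1, N => (Finset.range N).biUnion fun n =>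
      (furryG k n).image fun g => (Fin.cons (n + 1) g : Fin (k + 1) → ℕ)

lemma mem_furryG (k N : ℕ) (f : Fin k → ℕ) :
    f ∈ furryG k N ↔ (StrictAnti f ∧ ∀ i, 0 < f i) ∧ ∀ i, f i ≤ N := by
  induction k generalizing N with
  | zero =>
    simp only [furryG, Finset.mem_univ, true_iff]
    exact ⟨⟨fun i => i.elim0, fun i => i.elim0⟩, fun i => i.elim0⟩
  | succ k ih =>
    simp only [furryG, Finset.mem_biUnion, Finset.mem_range, Finset.mem_image, ih]
    constructor
    · rintro ⟨n, hn, g, ⟨⟨hg, hp⟩, hb⟩, rfl⟩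
      refine ⟨⟨?_, ?_⟩, ?_⟩
      · intro i j hij
        induction j using Fin.cases with
        | zero => exact absurd hij (Fin.not_lt_zero i)
        | succ j =>
          induction i using Fin.cases with
          | zero => simpa using Nat.lt_succ_of_le (hb j)
          | succ i => simpa using hg (Fin.succ_lt_succ_iff.mp hij)
      · intro i
        induction i using Fin.cases with
        | zero => simp
        | succ i => simpa using hp i
      · intro i
        induction i using Fin.cases with
        | zero => simpa using hn
        | succ i => simpa using (hb i).trans hn.le
    · rintro ⟨⟨hf, hp⟩, hb⟩
      have h0 := hp 0
      refine ⟨f 0 - 1, by have := hb 0; omega, Fin.tail f, ⟨⟨?_, fun i => hp _⟩, ?_⟩, ?_⟩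
      · intro i j hij
        exact hf (Fin.succ_lt_succ_iff.mpr hij)
      · intro i
        have : f i.succ < f 0 := hf (Fin.succ_pos i)
        simp only [Fin.tail]
        omega
      · rw [Nat.sub_add_cancel h0]
        exact Fin.cons_self_tail f

lemma sum_furryG (k N : ℕ) (v : ℝ) :
    ∑ f ∈ furryG k N, ∏ i : Fin k, (1 - 1 / (v + ((i : ℕ) + 1))) ^ (f i) / (f i : ℝ)
      = furryF k N v := by
  induction k generalizing N v with
  | zero => simp [furryG, furryF]
  | succ k ih =>
    simp only [furryG, furryF]
    rw [Finset.sum_biUnion]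
    · refine Finset.sum_congr rfl fun n _ => ?_
      rw [Finset.sum_image (fun a _ b _ hab => (Fin.cons_injective2 hab).2), ← ih,
        Finset.mul_sum]
      refine Finset.sum_congr rfl fun g _ => ?_
      rw [Fin.prod_univ_succ]
      simp only [Fin.cons_zero, Fin.cons_succ, Fin.val_zero, Fin.val_succ]
      push_cast
      congr 1
      · simp
      · refine Finset.prod_congr rfl fun i _ => ?_
        rw [show v + ((i : ℕ) + 1 + 1 : ℝ) = v + 1 + ((i : ℕ) + 1) by ring]
    · intro a _ b _ hab
      simp only [Function.onFun]
      rw [Finset.disjoint_left]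
      intro f hfa hfb
      simp only [Finset.mem_image] at hfa hfb
      obtain ⟨g, -, rfl⟩ := hfa
      obtain ⟨g', -, h⟩ := hfb
      exact hab (by have := (Fin.cons_injective2 h).1; omega)

lemma furrySum_eq (k : ℕ) (u q : ℝ) (hu : (k : ℝ) ≤ u)
    (hle : ∀ N, furryF k N (u - k) ≤ q)
    (hlim : Filter.Tendsto (fun N => furryF k N (u - k)) Filter.atTop (nhds q)) :
    FurrySum k u = q := by
  classical
  unfold FurrySum
  set w : {f : Fin k → ℕ // StrictAnti f ∧ ∀ i, 0 < f i} → ℝ := fun f =>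
    ∏ i : Fin k, (1 - 1 / (u - (k : ℝ) + ((i : ℕ) + 1))) ^ (f.1 i) / (f.1 i : ℝ) with hw
  let G : ℕ → Finset {f : Fin k → ℕ // StrictAnti f ∧ ∀ i, 0 < f i} := fun N =>
    (furryG k N).subtype _
  have hG : ∀ N, ∑ f ∈ G N, w f = furryF k N (u - k) := by
    intro N
    rw [← sum_furryG]
    exact Finset.sum_subtype_of_mem
      (fun f : Fin k → ℕ => ∏ i : Fin k, (1 - 1 / (u - (k : ℝ) + ((i : ℕ) + 1))) ^ (f i) / (f i : ℝ))
      (fun f hf => ((mem_furryG k N f).1 hf).1)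
  have hmono : Monotone G := by
    intro a b hab f hf
    simp only [G, Finset.mem_subtype, mem_furryG] at hf ⊢
    exact ⟨hf.1, fun i => (hf.2 i).trans hab⟩
  have hex : ∀ f, ∃ N, f ∈ G N := by
    intro f
    refine ⟨∑ i, f.1 i, ?_⟩
    simp only [G, Finset.mem_subtype, mem_furryG]
    exact ⟨f.2, fun i => Finset.single_le_sum (f := f.1) (fun _ _ => Nat.zero_le _)
      (Finset.mem_univ i)⟩
  have hat := Filter.tendsto_atTop_finset_of_monotone hmono hex
  have hnn : ∀ f, 0 ≤ w f := by
    intro f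
    refine Finset.prod_nonneg fun i _ => ?_
    have : 0 ≤ 1 - 1 / (u - (k : ℝ) + ((i : ℕ) + 1)) := by
      rw [← add_assoc]
      exact furry_z_nonneg (by have : (0:ℝ) ≤ (i : ℕ) := by positivity
                               linarith)
    positivity
  have hsum : Summable w := by
    refine summable_of_sum_le hnn (c := q) fun s => ?_
    obtain ⟨N, hN⟩ := (hat.eventually (Filter.eventually_ge_atTop s)).exists
    calc ∑ f ∈ s, w f ≤ ∑ f ∈ G N, w f :=
          Finset.sum_le_sum_of_subset_of_nonneg hN fun f _ _ => hnn f
      _ ≤ q := by rw [hG]; exact hle N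
  have h1 := hsum.hasSum.comp hat
  refine tendsto_nhds_unique h1 (hlim.congr fun N => ?_)
  exact (hG N).symm


/-- Theorem 3: For every integer `k ≥ 1` and every real `u ≥ k`,
the Furry probability `P_k(u)` equals the convergent nested sum
`∑_{n₁ > … > n_k > 0} ∏ᵢ zᵢ^{nᵢ}/nᵢ` with `zᵢ = 1 − 1/(u−k+i)`. -/
theorem furry_nested_sum
    (P : ℕ → ℝ → ℝ)
    (hP0 : ∀ u : ℝ, 0 ≤ u → P 0 u = 1)
    (hPcont : ∀ k : ℕ, ContinuousOn (P (k + 1)) (Set.Ici ((k : ℝ) + 1)))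
    (hPinit : ∀ k : ℕ, P (k + 1) ((k : ℝ) + 1) = 0)
    (hPderiv : ∀ k : ℕ, ∀ u : ℝ, (k : ℝ) + 1 < u →
      HasDerivAt (P (k + 1)) (P k (u - 1) / u) u) :
    ∀ k : ℕ, 1 ≤ k → ∀ u : ℝ, (k : ℝ) ≤ u → P k u = FurrySum k u := by
  intro k _ u hu
  have key := furry_tendsto (fun k v => P k (v + k))
    (fun v hv => by simpa using hP0 v hv)
    (fun k => by
      cases k with
      | zero =>
        refine (continuousOn_const (c := (1:ℝ))).congr fun v hv => ?_
        simpa using hP0 v hv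
      | succ k =>
        refine (hPcont k).comp (by fun_prop) fun v hv => ?_
        simp only [Set.mem_Ici] at hv ⊢
        push_cast
        linarith)
    (fun k => by simpa using hPinit k)
    (fun k v hv => by
      have h := hPderiv k (v + ((k + 1 : ℕ) : ℝ)) (by push_cast; linarith)
      have h' := h.comp_add_const v ((k + 1 : ℕ) : ℝ)
      refine h'.congr_deriv ?_
      push_cast
      congr 1
      · congr 1; ring
      · ring)
    k (u - k) (by linarith)
  simp only [sub_add_cancel] at key
  exact (furrySum_eq k u (P k u) hu key.1 key.2).symm
end

section
/- For every real u ≥ 2, the Furry probability of weight two satisfies P_2(u) = (log²(u) − ζ(2))/2 + Li_2(1/u). -/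
/-- The classical polylogarithm `Li_k(z) = ∑_{n≥1} z^n/n^k`. -/
noncomputable def Li (k : ℕ) (z : ℝ) : ℝ :=
  ∑' n : ℕ, z ^ (n + 1) / ((n : ℝ) + 1) ^ k

/-- `ζ_k = Li_k(1)`. -/
noncomputable def zeta' (k : ℕ) : ℝ := Li k 1

theorem furry_mvt (f g f' : ℝ → ℝ) (a : ℝ) (hf : ContinuousOn f (Set.Ici a))
    (hg : ContinuousOn g (Set.Ici a)) (h0 : f a = g a)
    (hf' : ∀ x, a < x → HasDerivAt f (f' x) x) (hg' : ∀ x, a < x → HasDerivAt g (f' x) x)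
    (u : ℝ) (hu : a ≤ u) : f u = g u := by
  rcases hu.eq_or_lt with rfl | h
  · exact h0
  obtain ⟨c, hc, h2⟩ := exists_hasDerivAt_eq_slope (fun x => f x - g x) (fun x => f' x - f' x) h
    ((hf.sub hg).mono Set.Icc_subset_Ici_self)
    (fun x hx => (hf' x hx.1).sub (hg' x hx.1))
  have h3 : u - a ≠ 0 := by linarith
  field_simp at h2
  linarith

theorem Li2_summable : Summable (fun n : ℕ => 1 / ((n : ℝ) + 1) ^ 2) := by
  have := (summable_nat_add_iff 1).2 (Real.summable_one_div_nat_pow.2 (by norm_num : 1 < 2))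
  simpa using this

theorem Li2_cont : ContinuousOn (Li 2) (Set.Icc 0 1) := by
  unfold Li
  refine continuousOn_tsum (u := fun n : ℕ => 1 / ((n : ℝ) + 1) ^ 2) ?_ Li2_summable ?_
  · intro n; fun_prop
  · intro n x hx
    rw [Real.norm_of_nonneg (div_nonneg (pow_nonneg hx.1 _) (by positivity))]
    gcongr
    exact pow_le_one₀ hx.1 hx.2

theorem Li2_zero : Li 2 0 = 0 := by simp [Li]

theorem Li2_deriv (x : ℝ) (h0 : 0 < x) (h1 : x < 1) :
    HasDerivAt (Li 2) (-Real.log (1 - x) / x) x := by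
  obtain ⟨r, hr, hr1⟩ := exists_between h1
  have hr0 : 0 < r := h0.trans hr
  have key := hasDerivAt_tsum_of_isPreconnected (𝕜 := ℝ) (F := ℝ) (u := fun n : ℕ => r ^ n)
    (t := Set.Ioo 0 r) (y₀ := x) (y := x)
    (g := fun (n : ℕ) (z : ℝ) => z ^ (n + 1) / ((n : ℝ) + 1) ^ 2)
    (g' := fun (n : ℕ) (z : ℝ) => z ^ n / ((n : ℝ) + 1))
    (summable_geometric_of_lt_one hr0.le hr1) isOpen_Ioo isPreconnected_Ioo ?_ ?_ ⟨h0, hr⟩ ?_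
    ⟨h0, hr⟩
  · have h2 := (Real.hasSum_pow_div_log_of_abs_lt_one
      (by rw [abs_of_pos h0]; exact h1 : |x| < 1)).div_const x
    have h3 : (∑' n : ℕ, x ^ n / ((n : ℝ) + 1)) = -Real.log (1 - x) / x := by
      rw [← h2.tsum_eq]
      congr 1; ext n
      field_simp
      ring
    rw [← h3]
    exact key
  · intro n z hz
    have := (hasDerivAt_pow (n + 1) z).div_const (((n : ℝ) + 1) ^ 2)
    refine this.congr_deriv ?_
    have : (n : ℝ) + 1 ≠ 0 := by positivity
    push_cast
    field_simp
  · intro n z hz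
    rw [Real.norm_of_nonneg (div_nonneg (pow_nonneg hz.1.le _) (by positivity))]
    calc z ^ n / ((n : ℝ) + 1) ≤ z ^ n := div_le_self (pow_nonneg hz.1.le _) (by simp)
      _ ≤ r ^ n := pow_le_pow_left₀ hz.1.le hz.2.le _
  · refine Summable.of_nonneg_of_le (fun n => by positivity) (fun n => ?_) Li2_summable
    gcongr
    exact pow_le_one₀ h0.le h1.le

open Filter Topology in
theorem Li2_half : 2 * Li 2 (1 / 2) + (Real.log 2) ^ 2 = Li 2 1 := by
  set F : ℝ → ℝ := fun x => Li 2 x + Li 2 (1 - x) + Real.log x * Real.log (1 - x) with hF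
  have hd : ∀ x ∈ Set.Ioo (0 : ℝ) 1, HasDerivAt F 0 x := by
    rintro x ⟨h0, h1⟩
    have hs : HasDerivAt (fun x : ℝ => 1 - x) (-1) x := by
      simpa using (hasDerivAt_id x).const_sub 1
    have a := Li2_deriv x h0 h1
    have b := (Li2_deriv (1 - x) (by linarith) (by linarith)).comp x hs
    have c := (Real.hasDerivAt_log h0.ne').mul (hs.log (by linarith))
    have hx : 1 - x ≠ 0 := by linarith
    refine ((a.add b).add c).congr_deriv ?_
    rw [sub_sub_cancel]
    field_simp
    ring
  have hc : ∀ x ∈ Set.Ioo (0 : ℝ) 1, F x = F (1 / 2) := by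
    intro x hx
    exact isOpen_Ioo.is_const_of_deriv_eq_zero isPreconnected_Ioo
      (fun y hy => (hd y hy).differentiableAt.differentiableWithinAt)
      (fun y hy => (hd y hy).deriv) hx (by norm_num)
  have hmem : ∀ᶠ x : ℝ in 𝓝[>] 0, x ∈ Set.Ioo (0 : ℝ) 1 := Ioo_mem_nhdsGT one_pos
  have t1 : Tendsto (fun x : ℝ => Li 2 x) (𝓝[>] 0) (𝓝 0) := by
    have := Li2_cont 0 (by simp)
    rw [ContinuousWithinAt, Li2_zero] at this
    refine this.comp (tendsto_nhdsWithin_iff.2 ⟨tendsto_id.mono_left nhdsWithin_le_nhds, ?_⟩)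
    filter_upwards [hmem] with x hx using ⟨hx.1.le, hx.2.le⟩
  have t2 : Tendsto (fun x : ℝ => Li 2 (1 - x)) (𝓝[>] 0) (𝓝 (Li 2 1)) := by
    have := Li2_cont 1 (by simp)
    refine Tendsto.comp this (tendsto_nhdsWithin_iff.2 ⟨?_, ?_⟩)
    · have : Continuous (fun x : ℝ => 1 - x) := by fun_prop
      simpa using (this.tendsto 0).mono_left (nhdsWithin_le_nhds (s := Set.Ioi 0))
    filter_upwards [hmem] with x hx
    exact ⟨by linarith [hx.2], by linarith [hx.1]⟩
  have t3 : Tendsto (fun x : ℝ => Real.log x * Real.log (1 - x)) (𝓝[>] 0) (𝓝 0) := by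
    have hs : HasDerivAt (fun x : ℝ => Real.log (1 - x)) (-1) 0 := by
      have := ((hasDerivAt_id (0 : ℝ)).const_sub 1).log (by simp)
      simpa using this
    have h1 := (hasDerivAt_iff_tendsto_slope.1 hs).mono_left
      (nhdsWithin_mono (0 : ℝ) (fun x (hx : 0 < x) => hx.ne'))
    have h0 : Tendsto (fun x : ℝ => Real.log x * x) (𝓝[>] 0) (𝓝 0) := by
      simpa only [Real.rpow_one] using tendsto_log_mul_rpow_nhdsGT_zero zero_lt_one
    have h2 := h0.mul h1
    rw [zero_mul] at h2
    refine h2.congr' ?_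
    filter_upwards [hmem] with x hx
    have := hx.1.ne'
    simp [slope_def_field]
    field_simp
  have t4 := (t1.add t2).add t3
  have t5 : Tendsto F (𝓝[>] 0) (𝓝 (F (1 / 2))) := by
    refine tendsto_const_nhds.congr' ?_
    filter_upwards [hmem] with x hx using (hc x hx).symm
  have h := tendsto_nhds_unique t5 t4
  simp only [hF] at h
  norm_num at h
  rw [← h]
  norm_num [Real.log_inv, Real.log_div]
  ring

theorem furry_P2
    (P : ℕ → ℝ → ℝ)
    (hP0 : ∀ u : ℝ, 0 ≤ u → P 0 u = 1)
    (hPcont : ∀ k : ℕ, ContinuousOn (P (k + 1)) (Set.Ici ((k : ℝ) + 1)))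
    (hPinit : ∀ k : ℕ, P (k + 1) ((k : ℝ) + 1) = 0)
    (hPderiv : ∀ k : ℕ, ∀ u : ℝ, (k : ℝ) + 1 < u →
      HasDerivAt (P (k + 1)) (P k (u - 1) / u) u) :
    ∀ u : ℝ, 2 ≤ u → P 2 u = ((Real.log u) ^ 2 - zeta' 2) / 2 + Li 2 (1 / u) := by
  have c1 := hPcont 0
  have c2 := hPcont 1
  have i1 := hPinit 0
  have i2 := hPinit 1
  have d1 := hPderiv 0
  have d2 := hPderiv 1
  norm_num at c1 c2 i1 i2 d1 d2
  have h1 : ∀ u : ℝ, 1 ≤ u → P 1 u = Real.log u := by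
    refine furry_mvt _ _ (fun u => 1 / u) 1 c1 ?_ (by simp [i1]) ?_ ?_
    · exact Real.continuousOn_log.mono (fun x hx => by
        have : (1 : ℝ) ≤ x := hx
        simp; linarith)
    · intro x hx
      have := d1 x hx
      rwa [hP0 _ (by linarith)] at this
    · intro x hx
      simpa using Real.hasDerivAt_log (by linarith : x ≠ 0)
  have hg : ∀ x : ℝ, 1 < x → HasDerivAt
      (fun u : ℝ => ((Real.log u) ^ 2 - zeta' 2) / 2 + Li 2 (1 / u)) (Real.log (x - 1) / x) x := by
    intro x hx
    have hx0 : x ≠ 0 := by linarith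
    have hx1 : x - 1 ≠ 0 := by linarith
    have a := ((((Real.hasDerivAt_log hx0).pow 2).sub_const (zeta' 2)).div_const 2)
    have hi : HasDerivAt (fun u : ℝ => 1 / u) (-(x ^ 2)⁻¹) x := by
      simpa using hasDerivAt_inv hx0
    have b := (Li2_deriv (1 / x) (by positivity)
      (by rw [div_lt_one (by linarith)]; exact hx)).comp x hi
    refine (a.add b).congr_deriv ?_
    have : 1 - 1 / x = (x - 1) / x := by field_simp
    rw [this, Real.log_div hx1 hx0]
    field_simp
    ring
  refine furry_mvt _ _ (fun u => Real.log (u - 1) / u) 2 c2 ?_ ?_ ?_ ?_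
  · intro x hx
    have : (2 : ℝ) ≤ x := hx
    exact (hg x (by linarith)).continuousAt.continuousWithinAt
  · rw [i2, zeta', ← Li2_half]; ring
  · intro x hx
    have := d2 x hx
    rwa [h1 _ (by linarith)] at this
  · intro x hx
    exact hg x (by linarith)
end
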